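/- Let Γ = (G, I, O, λ) be a labelled open graph that admits a focussed Pauli flow, and let p̂ be any focussed set for Γ. Then (p̂ ∪ Odd(p̂)) ∩ O = ∅ if and only if p̂ = ∅. -/

import Mathlib

open scoped symmDiff

inductive MeasLabel : Type
  | XY | XZ | YZ | X | Y | Z
deriving DecidableEq

/-- A labelled open graph: a finite simple graph with input and output sets and a
measurement labelling (only its values on non-outputs are ever used). -/
structure LOG (V : Type) [Fintype V] where
  G : SimpleGraph V
  I : Set V
  O : Set V
  lam : V → MeasLabel

namespace LOG

variable {V : Type} [Fintype V]

/-- The odd neighbourhood of `A`: vertices with an odd number of neighbours in `A`. -/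
def odd (G : SimpleGraph V) (A : Set V) : Set V :=
  {w | Odd ((G.neighborSet w ∩ A).ncard)}

/-- `v` is a measured (non-output) vertex whose label lies in `s`.  (The labelling of a
labelled open graph is only defined on non-outputs.) -/
def labIn (Γ : LOG V) (v : V) (s : Set MeasLabel) : Prop :=
  v ∉ Γ.O ∧ Γ.lam v ∈ s

/-- The Pauli flow conditions for a map `p` and a strict partial order `prec` (`≺`). -/
structure IsPauliFlow (Γ : LOG V) (p : V → Set V) (prec : V → V → Prop) : Prop where
  irrefl : ∀ a, ¬ prec a a
  trans : ∀ a b c, prec a b → prec b c → prec a c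
  psub : ∀ u, u ∉ Γ.O → ∀ v ∈ p u, v ∉ Γ.I
  pf1 : ∀ u, u ∉ Γ.O → ∀ v ∈ p u, u ≠ v →
    ¬ Γ.labIn v {MeasLabel.X, MeasLabel.Y} → prec u v
  pf2 : ∀ u, u ∉ Γ.O → ∀ v ∈ odd Γ.G (p u), u ≠ v →
    ¬ Γ.labIn v {MeasLabel.Y, MeasLabel.Z} → prec u v
  pf3 : ∀ u, u ∉ Γ.O → ∀ v, ¬ prec u v → u ≠ v →
    Γ.labIn v {MeasLabel.Y} → (v ∈ p u ↔ v ∈ odd Γ.G (p u))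
  pf4 : ∀ u, u ∉ Γ.O → Γ.lam u = MeasLabel.XY → u ∉ p u ∧ u ∈ odd Γ.G (p u)
  pf5 : ∀ u, u ∉ Γ.O → Γ.lam u = MeasLabel.XZ → u ∈ p u ∧ u ∈ odd Γ.G (p u)
  pf6 : ∀ u, u ∉ Γ.O → Γ.lam u = MeasLabel.YZ → u ∈ p u ∧ u ∉ odd Γ.G (p u)
  pf7 : ∀ u, u ∉ Γ.O → Γ.lam u = MeasLabel.X → u ∈ odd Γ.G (p u)
  pf8 : ∀ u, u ∉ Γ.O → Γ.lam u = MeasLabel.Z → u ∈ p u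
  pf9 : ∀ u, u ∉ Γ.O → Γ.lam u = MeasLabel.Y →
    ((u ∈ p u ∧ u ∉ odd Γ.G (p u)) ∨ (u ∉ p u ∧ u ∈ odd Γ.G (p u)))

/-- `phat` is focussed over `S`. -/
def FocussedOver (Γ : LOG V) (phat S : Set V) : Prop :=
  (∀ w ∈ S ∩ phat, Γ.lam w ∈ ({MeasLabel.XY, MeasLabel.X, MeasLabel.Y} : Set MeasLabel)) ∧
  (∀ w ∈ S ∩ odd Γ.G phat,
    Γ.lam w ∈ ({MeasLabel.XZ, MeasLabel.YZ, MeasLabel.Y, MeasLabel.Z} : Set MeasLabel)) ∧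
  (∀ w ∈ S, Γ.lam w = MeasLabel.Y → (w ∈ phat ↔ w ∈ odd Γ.G phat))

/-- A focussed set for `Γ`: a subset of the non-inputs that is focussed over all
non-outputs. -/
def IsFocussedSet (Γ : LOG V) (phat : Set V) : Prop :=
  (∀ v ∈ phat, v ∉ Γ.I) ∧ FocussedOver Γ phat {v | v ∉ Γ.O}

/-- A Pauli flow map `p` is focussed if each `p v` is focussed over the measured
vertices other than `v`. -/
def IsFocussed (Γ : LOG V) (p : V → Set V) : Prop :=
  ∀ v, v ∉ Γ.O → FocussedOver Γ (p v) ({w | w ∉ Γ.O} \ {v})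

/-- `Vcum prec k` is `V_{∪k}^≺`, the union of the layers up to depth `k`. -/
def Vcum (prec : V → V → Prop) : ℕ → Set V
  | 0 => {v | ∀ w, ¬ prec v w}
  | k + 1 => Vcum prec k ∪ {v | v ∉ Vcum prec k ∧ ∀ w, w ∉ Vcum prec k → ¬ prec v w}

/-- `Vlayer prec k` is `V_k^≺`, the `≺`-maximal elements among the vertices not of
smaller depth. -/
def Vlayer (prec : V → V → Prop) : ℕ → Set V
  | 0 => {v | ∀ w, ¬ prec v w}
  | k + 1 => {v | v ∉ Vcum prec k ∧ ∀ w, w ∉ Vcum prec k → ¬ prec v w}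

/-- `prec` is more delayed than `prec'`. -/
def MoreDelayed (prec prec' : V → V → Prop) : Prop :=
  (∀ k, (Vcum prec' k).ncard ≤ (Vcum prec k).ncard) ∧
  ∃ k, (Vcum prec' k).ncard < (Vcum prec k).ncard

/-- A maximally delayed Pauli flow: no Pauli flow for the same labelled open graph is
more delayed. -/
def IsMaxDelayed (Γ : LOG V) (p : V → Set V) (prec : V → V → Prop) : Prop :=
  IsPauliFlow Γ p prec ∧
  ∀ q prec', IsPauliFlow Γ q prec' → ¬ MoreDelayed prec' prec

/-- `Λ_u^P`: the measured vertices other than `u` whose label is `P`. -/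
def LamP (Γ : LOG V) (u : V) (P : MeasLabel) : Set V :=
  {v | v ∉ Γ.O ∧ v ≠ u ∧ Γ.lam v = P}

/-- `V_{k+1}^{≺,XY}` where `A = V_{∪k}^≺`. -/
def VXY (Γ : LOG V) (A : Set V) : Set V :=
  {u | u ∉ Γ.O ∧ Γ.lam u ∈ ({MeasLabel.XY, MeasLabel.X, MeasLabel.Y} : Set MeasLabel) ∧
    ∃ K, K ⊆ (A ∪ LamP Γ u MeasLabel.X ∪ LamP Γ u MeasLabel.Y) ∩ {v | v ∉ Γ.I} ∧
      (K ∩ LamP Γ u MeasLabel.Y) \ A = (odd Γ.G K ∩ LamP Γ u MeasLabel.Y) \ A ∧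
      odd Γ.G K \ (A ∪ LamP Γ u MeasLabel.Y ∪ LamP Γ u MeasLabel.Z) = {u}}

/-- `V_{k+1}^{≺,XZ}` where `A = V_{∪k}^≺`. -/
def VXZ (Γ : LOG V) (A : Set V) : Set V :=
  {u | u ∉ Γ.O ∧ Γ.lam u ∈ ({MeasLabel.XZ, MeasLabel.X, MeasLabel.Z} : Set MeasLabel) ∧
    ∃ K, K ⊆ (A ∪ LamP Γ u MeasLabel.X ∪ LamP Γ u MeasLabel.Y) ∩ {v | v ∉ Γ.I} ∧
      (K ∩ LamP Γ u MeasLabel.Y) \ A = (odd Γ.G (K ∪ {u}) ∩ LamP Γ u MeasLabel.Y) \ A ∧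
      odd Γ.G (K ∪ {u}) \ (A ∪ LamP Γ u MeasLabel.Y ∪ LamP Γ u MeasLabel.Z) = {u}}

/-- `V_{k+1}^{≺,YZ}` where `A = V_{∪k}^≺`. -/
def VYZ (Γ : LOG V) (A : Set V) : Set V :=
  {u | u ∉ Γ.O ∧ Γ.lam u ∈ ({MeasLabel.YZ, MeasLabel.Y, MeasLabel.Z} : Set MeasLabel) ∧
    ∃ K, K ⊆ (A ∪ LamP Γ u MeasLabel.X ∪ LamP Γ u MeasLabel.Y) ∩ {v | v ∉ Γ.I} ∧
      (K ∩ LamP Γ u MeasLabel.Y) \ A = (odd Γ.G (K ∪ {u}) ∩ LamP Γ u MeasLabel.Y) \ A ∧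
      odd Γ.G (K ∪ {u}) \ (A ∪ LamP Γ u MeasLabel.Y ∪ LamP Γ u MeasLabel.Z) = ∅}

end LOG


open Classical in
/-- Indicator function with values in `ZMod 2`. -/
noncomputable def chi2 {V : Type} (A : Set V) (w : V) : ZMod 2 := if w ∈ A then 1 else 0

open Classical in
theorem chi2_odd {V : Type} [Fintype V] (G : SimpleGraph V) (A : Set V) (w : V) :
    chi2 (LOG.odd G A) w = ∑ u, (if G.Adj w u then 1 else 0) * chi2 A u := by
  have h1 : (∑ u, (if G.Adj w u then (1 : ZMod 2) else 0) * chi2 A u)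
      = (((G.neighborSet w ∩ A).ncard : ℕ) : ZMod 2) := by
    rw [Set.ncard_eq_toFinset_card', Finset.card_eq_sum_ones, Nat.cast_sum,
      ← Finset.sum_filter_add_sum_filter_not Finset.univ (fun u => u ∈ G.neighborSet w ∩ A)]
    rw [Finset.sum_eq_zero (s := Finset.univ.filter fun u => ¬ (u ∈ G.neighborSet w ∩ A)), add_zero]
    · refine Finset.sum_congr (by ext; simp) ?_
      intro u hu
      simp at hu
      simp [chi2, hu.1, hu.2]
    · intro u hu
      simp at hu
      by_cases h : G.Adj w u
      · simp [chi2, hu h]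
      · simp [h]
  rw [h1]
  unfold chi2 LOG.odd
  by_cases h : Odd ((G.neighborSet w ∩ A).ncard)
  · simp only [Set.mem_ofPred_eq, h, if_true]
    exact ((ZMod.natCast_eq_one_iff_odd).2 h).symm
  · simp only [Set.mem_ofPred_eq, h, if_false]
    exact ((ZMod.natCast_eq_zero_iff_even).2 (Nat.not_odd_iff_even.1 h)).symm

theorem chi2_symp {V : Type} [Fintype V] (G : SimpleGraph V) (A B : Set V) :
    ∑ w, (chi2 A w * chi2 (LOG.odd G B) w + chi2 (LOG.odd G A) w * chi2 B w) = 0 := by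
  classical
  have h : ∑ w, chi2 A w * chi2 (LOG.odd G B) w = ∑ w, chi2 (LOG.odd G A) w * chi2 B w := by
    simp only [chi2_odd, Finset.mul_sum, Finset.sum_mul]
    rw [Finset.sum_comm]
    refine Finset.sum_congr rfl fun x _ => Finset.sum_congr rfl fun y _ => ?_
    rw [G.adj_comm]
    ring
  rw [Finset.sum_add_distrib, h]
  exact CharTwo.add_self_eq_zero _

open LOG in
/-- for a labelled open graph with a focussed Pauli flow, a focussed set
touches the outputs (via itself or its odd neighbourhood) iff it is non-empty. -/
theorem focussedSet_outputs_empty_iff {V : Type} [Fintype V] (Γ : LOG V)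
    (h : ∃ p prec, IsPauliFlow Γ p prec ∧ IsFocussed Γ p)
    (phat : Set V) (hphat : IsFocussedSet Γ phat) :
    (phat ∪ odd Γ.G phat) ∩ Γ.O = ∅ ↔ phat = ∅ := by
  classical
  obtain ⟨p, prec, hp, hf⟩ := h
  obtain ⟨-, f1, f2, f3⟩ := hphat
  constructor
  · intro he
    have hO : ∀ w ∈ Γ.O, w ∉ phat ∧ w ∉ odd Γ.G phat := by
      intro w hw
      constructor <;> intro h2 <;>
        exact (Set.eq_empty_iff_forall_notMem.1 he w) ⟨by simp [h2], hw⟩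
    rw [Set.eq_empty_iff_forall_notMem]
    intro v hv
    have hvO : v ∉ Γ.O := fun h => (hO v h).1 hv
    obtain ⟨g1, g2, g3⟩ := hf v hvO
    have hs := chi2_symp Γ.G phat (p v)
    rw [Finset.sum_eq_single v] at hs
    · have a1 := f1 v ⟨hvO, hv⟩
      have a2 := fun h => f2 v ⟨hvO, h⟩
      have a3 := f3 v hvO
      have b4 := hp.pf4 v hvO
      have b7 := hp.pf7 v hvO
      have b9 := hp.pf9 v hvO
      clear f1 f2 f3 g1 g2 g3 he hO hf hp
      simp only [chi2, hv, if_true] at hs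
      generalize Γ.lam v = l at *
      generalize (v ∈ odd Γ.G phat) = P1 at *
      generalize (v ∈ p v) = P2 at *
      generalize (v ∈ odd Γ.G (p v)) = P3 at *
      clear hvO
      cases l <;> simp at a1 a2 a3 b4 b7 b9 <;>
        by_cases P1 <;> by_cases P2 <;> by_cases P3 <;> simp_all
    · intro w _ hwv
      by_cases hw : w ∈ Γ.O
      · simp [chi2, hO w hw]
      have a1 := fun h => f1 w ⟨hw, h⟩
      have a2 := fun h => f2 w ⟨hw, h⟩
      have a3 := f3 w hw
      have b1 := fun h => g1 w ⟨⟨hw, hwv⟩, h⟩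
      have b2 := fun h => g2 w ⟨⟨hw, hwv⟩, h⟩
      have b3 := g3 w ⟨hw, hwv⟩
      clear hs f1 f2 f3 g1 g2 g3 he hO hf
      have two : (1 : ZMod 2) + 1 = 0 := by decide
      clear hp hv hvO hw hwv
      simp only [chi2]
      generalize Γ.lam w = l at *
      generalize (w ∈ phat) = P0 at *
      generalize (w ∈ odd Γ.G phat) = P1 at *
      generalize (w ∈ p v) = P2 at *
      generalize (w ∈ odd Γ.G (p v)) = P3 at *
      cases l <;> simp at a1 a2 a3 b1 b2 b3 <;>
        first
        | (simp [a1, b1]; done)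
        | (simp [a2, b2]; done)
        | (by_cases P1 <;> by_cases P3 <;> simp_all)
    · simp
  · rintro rfl
    ext w
    simp [odd]
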